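/- Let Q be the star quiver with vertices 0, 1, …, n (n ≥ 1) and arrows α_i : i → 0 for 1 ≤ i ≤ n. Then H¹_BW(C, D̂∘t) is isomorphic, as a k-vector space, to the quotient of D̂(0)^{⊕n} (coordinates indexed by the arrows α_n, α_1, …, α_{n−1}) by the subspace spanned by: (i) all diagonal vectors (m, m, …, m) with m ∈ D̂(0); (ii) for each 1 ≤ k ≤ n−1, all vectors whose α_k-coordinate is D̂(α_k)(u) for some u ∈ D̂(k) and whose other coordinates are 0; and (iii) for each m ∈ D̂(n), the vector whose α_n-coordinate is 0 and whose α_k-coordinate equals D̂(α_n)(m) for every 1 ≤ k ≤ n−1. -/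

import Mathlib

/-- Paths in a quiver given by source and target maps `s t : E → P`.
`QPath s t x y` is the type of paths from `x` to `y`. -/
inductive QPath {P E : Type} (s t : E → P) : P → P → Type
  | nil (x : P) : QPath s t x x
  | cons {x : P} (e : E) (p : QPath s t x (s e)) : QPath s t x (t e)

namespace QPath

variable {P E : Type} {s t : E → P}

/-- Concatenation of paths. -/
def comp : ∀ {x y z : P}, QPath s t x y → QPath s t y z → QPath s t x z
  | _, _, _, p, .nil _ => p
  | _, _, _, p, .cons e q => .cons e (comp p q)

/-- The length-one path given by a single arrow. -/
def single (e : E) : QPath s t (s e) (t e) := .cons e (.nil (s e))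

/-- The length of a path. -/
def length : ∀ {x y : P}, QPath s t x y → ℕ
  | _, _, .nil _ => 0
  | _, _, .cons _ p => length p + 1

/-- The list of arrows occurring in a path. -/
def arrows : ∀ {x y : P}, QPath s t x y → List E
  | _, _, .nil _ => []
  | _, _, .cons e p => e :: arrows p

end QPath

section BW

variable (k : Type) [Field k] {P E : Type} (s t : E → P)
  (D : P → Type) [∀ x, AddCommGroup (D x)] [∀ x, Module k (D x)]
  (De : ∀ e : E, D (s e) →ₗ[k] D (t e))

/-- The value of a functor (given on vertices by `D` and on arrows by `De`)
on a path, i.e. the composite of the linear maps along the path. -/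
def pathMap : ∀ {x y : P}, QPath s t x y → (D x →ₗ[k] D y)
  | _, _, .nil _ => LinearMap.id
  | _, _, .cons e p => (De e).comp (pathMap p)

/-- `d` is a derivation with coefficients in the natural system `D̂ ∘ t`:
`d (q ∘ p) = D̂(q) (d p) + d q`. -/
def IsDerivation (d : ∀ x y : P, QPath s t x y → D y) : Prop :=
  ∀ (x y z : P) (p : QPath s t x y) (q : QPath s t y z),
    d x z (p.comp q) = pathMap k s t D De q (d x y p) + d y z q

/-- The space of derivations. -/
def Der : Submodule k (∀ x y : P, QPath s t x y → D y) where
  carrier := {d | IsDerivation k s t D De d}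
  add_mem' := by
    intro a b ha hb x y z p q
    simp only [Pi.add_apply, ha x y z p q, hb x y z p q, map_add]
    abel
  zero_mem' := by
    intro x y z p q
    simp
  smul_mem' := by
    intro c a ha x y z p q
    simp only [Pi.smul_apply, ha x y z p q, map_smul, smul_add]

/-- The space of inner derivations. -/
def Ider : Submodule k (∀ x y : P, QPath s t x y → D y) where
  carrier := {d | ∃ nn : ∀ x : P, D x, ∀ (x y : P) (p : QPath s t x y),
    d x y p = pathMap k s t D De p (nn x) - nn y}
  add_mem' := by
    rintro a b ⟨na, hna⟩ ⟨nb, hnb⟩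
    refine ⟨na + nb, fun x y p => ?_⟩
    simp only [Pi.add_apply, hna x y p, hnb x y p, map_add]
    abel
  zero_mem' := ⟨0, fun x y p => by simp⟩
  smul_mem' := by
    rintro c a ⟨na, hna⟩
    refine ⟨c • na, fun x y p => ?_⟩
    simp only [Pi.smul_apply, hna x y p, map_smul, smul_sub]

/-- Inner derivations, as a submodule of the space of derivations. -/
def IderInDer : Submodule k ↥(Der k s t D De) :=
  (Ider k s t D De).comap (Der k s t D De).subtype

/-- The first Baues–Wirsching cohomology `Der/IDer`. -/
abbrev BW1 := ↥(Der k s t D De) ⧸ IderInDer k s t D De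

/-- The restriction map `ρ` sending a derivation to its values on the arrows. -/
def restrict : ↥(Der k s t D De) →ₗ[k] (∀ e : E, D (t e)) where
  toFun d := fun e => (d : ∀ x y : P, QPath s t x y → D y) (s e) (t e) (QPath.single e)
  map_add' a b := rfl
  map_smul' c a := rfl

end BW

/-- Source map of the star quiver with center `0`: the arrow indexed by
`i : Fin n` is `α_{i+1} : i+1 → 0`. -/
def starS (n : ℕ) (e : Fin n) : Fin (n + 1) := e.succ

/-- Target map of the star quiver: every arrow ends at the center `0`. -/
def starT (n : ℕ) (_ : Fin n) : Fin (n + 1) := (0 : Fin (n + 1))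

section BW

variable (k : Type) [Field k] {P E : Type} (s t : E → P)
  (D : P → Type) [∀ x, AddCommGroup (D x)] [∀ x, Module k (D x)]
  (De : ∀ e : E, D (s e) →ₗ[k] D (t e))

theorem pathMap_single (e : E) : pathMap k s t D De (.single e) = De e := by
  simp only [QPath.single, pathMap, LinearMap.comp_id]

theorem pathMap_comp {x y z : P} (p : QPath s t x y) (q : QPath s t y z) :
    pathMap k s t D De (p.comp q) = (pathMap k s t D De q).comp (pathMap k s t D De p) := by
  induction q with
  | nil => simp only [QPath.comp, pathMap, LinearMap.id_comp]
  | cons e q ih => simp only [QPath.comp, pathMap, ih, LinearMap.comp_assoc]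

/-- The extension of a family of values on the arrows to all paths by the Leibniz rule. -/
def extendPath (f : ∀ e : E, D (t e)) : ∀ {x y : P}, QPath s t x y → D y
  | _, _, .nil _ => 0
  | _, _, .cons e p => De e (extendPath f p) + f e

theorem extendPath_comp (f : ∀ e : E, D (t e)) {x y z : P} (p : QPath s t x y)
    (q : QPath s t y z) :
    extendPath k s t D De f (p.comp q) =
      pathMap k s t D De q (extendPath k s t D De f p) + extendPath k s t D De f q := by
  induction q with
  | nil => simp only [QPath.comp, pathMap, extendPath, LinearMap.id_apply, add_zero]
  | cons e q ih =>
    simp only [QPath.comp, pathMap, extendPath, ih, map_add, add_assoc, LinearMap.comp_apply]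

theorem IsDerivation.apply_nil {d : ∀ x y : P, QPath s t x y → D y}
    (hd : IsDerivation k s t D De d) (x : P) : d x x (.nil x) = 0 := by
  simpa [QPath.comp, pathMap] using hd x x x (.nil x) (.nil x)

theorem IsDerivation.eq_extendPath {d : ∀ x y : P, QPath s t x y → D y}
    (hd : IsDerivation k s t D De d) {x y : P} (p : QPath s t x y) :
    d x y p = extendPath k s t D De (fun e => d (s e) (t e) (.single e)) p := by
  induction p with
  | nil => simp only [extendPath, hd.apply_nil]
  | cons e p ih =>
    have h := hd _ _ _ p (.single e)
    rw [ih, pathMap_single] at h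
    simpa only [QPath.single, QPath.comp, extendPath] using h

theorem restrict_bijective : Function.Bijective (restrict k s t D De) := by
  refine ⟨fun a b hab => Subtype.ext ?_, fun f => ?_⟩
  · funext x y p
    rw [a.2.eq_extendPath k s t D De p, b.2.eq_extendPath k s t D De p]
    exact congrArg (fun f => extendPath k s t D De f p) hab
  · refine ⟨⟨fun _ _ p => extendPath k s t D De f p,
      fun _ _ _ p q => extendPath_comp k s t D De f p q⟩, ?_⟩
    funext e
    change extendPath k s t D De f (.single e) = f e
    simp only [QPath.single, extendPath, map_zero, zero_add]

theorem isDerivation_inner (nn : ∀ x : P, D x) :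
    IsDerivation k s t D De fun x y p => pathMap k s t D De p (nn x) - nn y := by
  intro x y z p q
  simp only [pathMap_comp, LinearMap.comp_apply, map_sub]
  abel

theorem mem_map_restrict_iderInDer (v : ∀ e : E, D (t e)) :
    v ∈ (IderInDer k s t D De).map (restrict k s t D De) ↔
      ∃ nn : ∀ x : P, D x, ∀ e : E, v e = De e (nn (s e)) - nn (t e) := by
  constructor
  · rintro ⟨d, ⟨nn, hnn⟩, rfl⟩
    exact ⟨nn, fun e => (hnn _ _ (.single e)).trans (by rw [pathMap_single])⟩
  · rintro ⟨nn, hnn⟩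
    refine ⟨⟨_, isDerivation_inner k s t D De nn⟩, ⟨nn, fun _ _ _ => rfl⟩, funext fun e => ?_⟩
    rw [hnn e, ← pathMap_single k s t D De e]
    rfl

end BW

theorem single_eq_const_sub_ite {V : Type*} [AddCommGroup V] {n : ℕ} (i : Fin n) (x : V) :
    (Pi.single i x : Fin n → V) = (fun _ => x) - fun e : Fin n => if (e : ℕ) = i then 0 else x := by
  funext e
  by_cases he : e = i
  · simp [he]
  · simp [he, Fin.val_ne_of_ne he]

/-- the first Baues–Wirsching cohomology of the star quiver. -/
theorem statement6 (k : Type) [Field k] (n : ℕ) (hn : 1 ≤ n)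
    (D : Fin (n + 1) → Type) [∀ x, AddCommGroup (D x)] [∀ x, Module k (D x)]
    (De : ∀ e : Fin n, D (starS n e) →ₗ[k] D (starT n e)) :
    Nonempty (BW1 k (starS n) (starT n) D De ≃ₗ[k]
      ((∀ e : Fin n, D (starT n e)) ⧸
        Submodule.span k
          ({v : ∀ e : Fin n, D (starT n e) | ∃ mv : D (0 : Fin (n + 1)), v = fun _ => mv}
          ∪ {v : ∀ e : Fin n, D (starT n e) |
              ∃ i : Fin n, (i : ℕ) < n - 1 ∧ ∃ u : D (starS n i), v = Pi.single i (De i u)}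
          ∪ {v : ∀ e : Fin n, D (starT n e) |
              ∃ mv : D (starS n ⟨n - 1, by omega⟩),
                v = fun e : Fin n => if (e : ℕ) = n - 1 then (0 : D (starT n e))
                  else De ⟨n - 1, by omega⟩ mv}))) := by
  refine ⟨Submodule.Quotient.equiv _ _
    (LinearEquiv.ofBijective _ (restrict_bijective k (starS n) (starT n) D De)) ?_⟩
  change (IderInDer k (starS n) (starT n) D De).map (restrict k (starS n) (starT n) D De) = _
  apply le_antisymm
  · intro v hv
    obtain ⟨nn, hnn⟩ := (mem_map_restrict_iderInDer k _ _ D De v).1 hv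
    have hsum : v = (fun _ => -nn 0) +
        ∑ i : Fin n, Pi.single (M := fun e => D (starT n e)) i (De i (nn (starS n i))) := by
      rw [Finset.univ_sum_single (fun i => De i (nn (starS n i)))]
      funext e
      rw [hnn e, sub_eq_neg_add]
      rfl
    rw [hsum]
    refine add_mem (Submodule.subset_span (Or.inl (Or.inl ⟨_, rfl⟩)))
      (sum_mem fun i _ => ?_)
    by_cases hi : (i : ℕ) < n - 1
    · exact Submodule.subset_span (Or.inl (Or.inr ⟨i, hi, _, rfl⟩))
    · have hlast : i = ⟨n - 1, by omega⟩ := Fin.ext (by change (i : ℕ) = n - 1; omega)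
      rw [hlast]
      generalize nn _ = m
      have hdiff : Pi.single (M := fun e => D (starT n e)) ⟨n - 1, by omega⟩
          (De ⟨n - 1, by omega⟩ m) = (fun _ => De ⟨n - 1, by omega⟩ m) -
            fun e : Fin n => if (e : ℕ) = n - 1 then (0 : D (starT n e))
              else De ⟨n - 1, by omega⟩ m :=
        single_eq_const_sub_ite (V := D 0) _ _
      rw [hdiff]
      exact sub_mem (Submodule.subset_span (Or.inl (Or.inl ⟨_, rfl⟩)))
        (Submodule.subset_span (Or.inr ⟨m, rfl⟩))
  · have key : ∀ (w₀ : D 0) (w : ∀ i : Fin n, D (starS n i)) (v : ∀ e : Fin n, D (starT n e)),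
        (∀ e, v e = De e (w e) - (show D (starT n e) from w₀)) →
        v ∈ (IderInDer k (starS n) (starT n) D De).map (restrict k (starS n) (starT n) D De) :=
      fun w₀ w v h => (mem_map_restrict_iderInDer k _ _ D De v).2 ⟨Fin.cons w₀ w, h⟩
    rw [Submodule.span_le]
    rintro v ((⟨m, rfl⟩ | ⟨i, -, u, rfl⟩) | ⟨m, rfl⟩)
    · refine key (-m) 0 _ fun e => ?_
      rw [Pi.zero_apply, map_zero]
      exact ((zero_sub _).trans (neg_neg m)).symm
    · refine key 0 (Pi.single i u) _ fun e => ?_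
      rw [← Pi.apply_single (fun e => De e) (fun e => map_zero _)]
      exact (sub_zero _).symm
    · refine key (-De ⟨n - 1, by omega⟩ m) (Pi.single ⟨n - 1, by omega⟩ (-m)) _ fun e => ?_
      by_cases he : (e : ℕ) = n - 1
      · rw [show e = ⟨n - 1, by omega⟩ from Fin.ext he]
        simp
      · have hne : e ≠ ⟨n - 1, by omega⟩ := fun h => he (congrArg Fin.val h)
        simp only [he, Pi.single_eq_of_ne hne, map_zero]
        exact ((zero_sub _).trans (neg_neg _)).symm
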